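/- Let k be a field of characteristic zero containing a primitive third root of unity ω, and let σ be the k-algebra automorphism of F = k(x,y) with σ(x) = y and σ(y) = (xy)^{-1} (an automorphism of order 3). Set a = x + ωy + ω²(xy)^{-1}, b = x^{-1} + ωy^{-1} + ω²xy, c = xy^{-1} + xy² + x^{-2}y^{-1} − 3, and f = a²b/c², g = b/a. Then σ(f) = f, σ(g) = g, {g,f} = gf, the subfield k(f,g) of F generated by f and g over k equals the fixed field F^σ, and consequently F^σ is Poisson-isomorphic to F. -/

import Mathlib

noncomputable section

/-- A Poisson bracket on a commutative `k`-algebra `R`: a `k`-bilinear antisymmetric map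
satisfying the Jacobi identity and the Leibniz rule in each argument. -/
structure PoissonBracket (k R : Type*) [CommRing k] [CommRing R] [Algebra k R] where
  bracket : R →ₗ[k] R →ₗ[k] R
  antisymm : ∀ a b : R, bracket a b = - bracket b a
  jacobi : ∀ a b c : R,
    bracket a (bracket b c) + bracket b (bracket c a) + bracket c (bracket a b) = 0
  leibniz : ∀ a b c : R, bracket a (b * c) = bracket a b * c + b * bracket a c

/-- The subalgebra of elements fixed by an algebra automorphism. -/
def fixedSubalgebra {k F : Type*} [CommSemiring k] [CommSemiring F] [Algebra k F]
    (σ : F ≃ₐ[k] F) : Subalgebra k F where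
  carrier := {a | σ a = a}
  mul_mem' := fun {a b} ha hb => by
    show σ (a * b) = a * b
    rw [map_mul, show σ a = a from ha, show σ b = b from hb]
  add_mem' := fun {a b} ha hb => by
    show σ (a + b) = a + b
    rw [map_add, show σ a = a from ha, show σ b = b from hb]
  one_mem' := map_one σ
  zero_mem' := map_zero σ
  algebraMap_mem' := fun r => σ.commutes r

namespace PoissonBracket

variable {k F : Type*} [Field k] [Field F] [Algebra k F] (P : PoissonBracket k F)

theorem leibniz_left (a b c : F) :
    P.bracket (a * b) c = P.bracket a c * b + a * P.bracket b c := by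
  rw [P.antisymm, P.leibniz, P.antisymm c a, P.antisymm c b]
  ring

theorem bracket_one (a : F) : P.bracket a 1 = 0 := by
  simpa using P.leibniz a 1 1

theorem bracket_algebraMap (a : F) (r : k) : P.bracket a (algebraMap k F r) = 0 := by
  rw [Algebra.algebraMap_eq_smul_one, map_smul, P.bracket_one, smul_zero]

theorem algebraMap_bracket (r : k) (a : F) : P.bracket (algebraMap k F r) a = 0 := by
  rw [P.antisymm, P.bracket_algebraMap, neg_zero]

theorem bracket_self [CharZero k] (a : F) : P.bracket a a = 0 := by
  have : CharZero F := charZero_of_injective_algebraMap (algebraMap k F).injective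
  exact self_eq_neg.mp (P.antisymm a a)

theorem bracket_inv (a : F) {b : F} (hb : b ≠ 0) :
    P.bracket a b⁻¹ = -(P.bracket a b / b ^ 2) := by
  have h := P.leibniz a b b⁻¹
  rw [mul_inv_cancel₀ hb, P.bracket_one] at h
  field_simp
  field_simp at h
  linear_combination -h

end PoissonBracket

/-- Two `φ`-derivations that agree on field generators are equal. -/
theorem LinearMap.eq_of_leibniz_of_adjoin_eq_top {k F L : Type*} [Field k] [Field F] [Field L]
    [Algebra k F] [Algebra k L] (φ : F →ₐ[k] L) (D E : F →ₗ[k] L)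
    (hD : ∀ a b, D (a * b) = D a * φ b + φ a * D b)
    (hE : ∀ a b, E (a * b) = E a * φ b + φ a * E b)
    {s : Set F} (hs : IntermediateField.adjoin k s = ⊤) (h : ∀ a ∈ s, D a = E a) : D = E := by
  have hD1 : D 1 = 0 := by simpa using hD 1 1
  have hE1 : E 1 = 0 := by simpa using hE 1 1
  ext t
  have ht : t ∈ IntermediateField.adjoin k s := hs ▸ IntermediateField.mem_top
  induction ht using IntermediateField.adjoin_induction with
  | mem a ha => exact h a ha
  | algebraMap r => rw [Algebra.algebraMap_eq_smul_one, map_smul, map_smul, hD1, hE1]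
  | add a b _ _ iha ihb => rw [map_add, map_add, iha, ihb]
  | mul a b _ _ iha ihb => rw [hD, hE, iha, ihb]
  | inv a _ iha =>
    rcases eq_or_ne a 0 with rfl | ha
    · simp
    have h1 := hD a a⁻¹
    have h2 := hE a a⁻¹
    rw [mul_inv_cancel₀ ha, hD1] at h1
    rw [mul_inv_cancel₀ ha, hE1] at h2
    refine mul_left_cancel₀ ((map_ne_zero φ).mpr ha) ?_
    linear_combination h2 - h1 - φ a⁻¹ * iha

/-- An endomorphism of a field generated by `x` and `y` that preserves the bracket of `y` and `x`
is a Poisson morphism. -/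
theorem PoissonBracket.map_bracket_of_adjoin_eq_top {k F : Type*} [Field k] [CharZero k] [Field F]
    [Algebra k F] (P : PoissonBracket k F) {x y : F}
    (hgen : IntermediateField.adjoin k {x, y} = ⊤) (φ : F →ₐ[k] F)
    (h : φ (P.bracket y x) = P.bracket (φ y) (φ x)) (u v : F) :
    φ (P.bracket u v) = P.bracket (φ u) (φ v) := by
  have key (u : F) (hx : φ (P.bracket u x) = P.bracket (φ u) (φ x))
      (hy : φ (P.bracket u y) = P.bracket (φ u) (φ y)) (v : F) :
      φ (P.bracket u v) = P.bracket (φ u) (φ v) := by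
    refine LinearMap.congr_fun (LinearMap.eq_of_leibniz_of_adjoin_eq_top φ
      (φ.toLinearMap ∘ₗ P.bracket u) (P.bracket (φ u) ∘ₗ φ.toLinearMap) ?_ ?_ hgen ?_) v
    · intro a b
      simp [P.leibniz]
    · intro a b
      simp [P.leibniz]
    · rintro a (rfl | rfl)
      exacts [hx, hy]
  have swap {u v : F} (h : φ (P.bracket u v) = P.bracket (φ u) (φ v)) :
      φ (P.bracket v u) = P.bracket (φ v) (φ u) := by
    rw [P.antisymm v, P.antisymm (φ v), map_neg, h]
  have self (u : F) : φ (P.bracket u u) = P.bracket (φ u) (φ u) := by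
    rw [P.bracket_self, P.bracket_self, map_zero]
  exact key u (swap (key x (self x) (swap h) u)) (swap (key y h (self y) u)) v

open IntermediateField in
/-- If `F = K(a)` with `a ^ 3 ∈ K`, and `σ` fixes `K` and multiplies `a` by a primitive cube root
of unity of the base field, then every element fixed by `σ` lies in `K`. -/
theorem IntermediateField.mem_of_fixed_of_cube_mem {k F : Type*} [Field k] [CharZero k] [Field F]
    [Algebra k F] (K : IntermediateField k F) (σ : F ≃ₐ[k] F) (hσ : ∀ t ∈ K, σ t = t)
    {ζ : k} (hζ : IsPrimitiveRoot ζ 3) {a : F} (ha : σ a = algebraMap k F ζ * a)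
    (ha3 : a ^ 3 ∈ K) (htop : K⟮a⟯ = ⊤) {t : F} (ht : σ t = t) : t ∈ K := by
  have : CharZero F := charZero_of_injective_algebraMap (algebraMap k F).injective
  have hint : IsIntegral K a :=
    .of_pow (n := 3) (by norm_num) (isIntegral_algebraMap (x := (⟨a ^ 3, ha3⟩ : K)))
  set w := algebraMap k F ζ with hw
  have hwprim : IsPrimitiveRoot w 3 := hζ.map_of_injective (algebraMap k F).injective
  have hw3 : w ^ 3 = 1 := hwprim.pow_eq_one
  have hwsum : 1 + w + w ^ 2 = 0 := by
    simpa [Finset.sum_range_succ] using hwprim.geom_sum_eq_zero (by norm_num)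
  have hσw : σ w = w := σ.commutes ζ
  have trace_mem (p : Polynomial K) :
      p.aeval a + σ (p.aeval a) + σ (σ (p.aeval a)) ∈ K := by
    induction p using Polynomial.induction_on' with
    | add p q hp hq =>
      simp only [map_add]
      convert add_mem hp hq using 1
      ring
    | monomial n r =>
      have hr : σ (r : F) = r := hσ r r.2
      have hn : (Polynomial.aeval a) (Polynomial.monomial n r) = r * a ^ n := by
        rw [Polynomial.aeval_monomial]; rfl
      simp only [hn, map_mul, map_pow, ha, hr, hσw]
      have : (r : F) * a ^ n + r * (w * a) ^ n + r * (w * (w * a)) ^ n =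
          r * ((1 + w ^ n + (w ^ n) ^ 2) * a ^ n) := by ring
      rw [this]
      refine mul_mem r.2 ?_
      rw [← Nat.div_add_mod n 3, pow_add, pow_mul, hw3, one_pow, one_mul, pow_add, pow_mul]
      have hlt : n % 3 < 3 := Nat.mod_lt _ (by norm_num)
      interval_cases n % 3
      · norm_num
        exact mul_mem (ofNat_mem K 3) (pow_mem ha3 _)
      · rw [pow_one, hwsum, zero_mul]
        exact zero_mem K
      · have : 1 + w ^ 2 + (w ^ 2) ^ 2 = 0 := by linear_combination hwsum + w * hw3
        rw [this, zero_mul]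
        exact zero_mem K
  have hmem : t ∈ K⟮a⟯.toSubalgebra := by
    rw [htop]; exact mem_top
  rw [adjoin_simple_toSubalgebra_of_isAlgebraic hint.isAlgebraic,
    Algebra.adjoin_singleton_eq_range_aeval] at hmem
  obtain ⟨p, rfl⟩ := hmem
  have h := trace_mem p
  change σ (p.aeval a) = p.aeval a at ht
  rw [ht, ht] at h
  have h3 : p.aeval a = (3 : F)⁻¹ * (p.aeval a + p.aeval a + p.aeval a) := by
    field_simp
    ring
  change p.aeval a ∈ K
  rw [h3]
  exact mul_mem (inv_mem (ofNat_mem K 3)) h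

section CyclicCubic

variable {F : Type*} [Field F] {w x y z a b c d s : F}

theorem three_mul_cyclic_quadratic (hw : w ^ 2 + w + 1 = 0)
    (ha : a = x + w * y + w ^ 2 * z) (hb : b = y * z + w * (x * z) + w ^ 2 * (x * y))
    (hd : d = x + w ^ 2 * y + w * z) (hs : s = x + y + z) : 3 * b = d ^ 2 - s * a := by
  subst ha hb hd hs
  grind

theorem nine_mul_cyclic_cubic (hw : w ^ 2 + w + 1 = 0) (hxyz : x * y * z = 1)
    (ha : a = x + w * y + w ^ 2 * z) (hc : c = x ^ 2 * z + y ^ 2 * x + z ^ 2 * y - 3)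
    (hd : d = x + w ^ 2 * y + w * z) (hs : s = x + y + z) :
    9 * c = (w - 1) * a ^ 3 + (w ^ 2 - 1) * d ^ 3 + 3 * s * a * d := by
  subst ha hc hd hs
  grind

theorem norm_relation_of_mul_eq_one (hw : w ^ 2 + w + 1 = 0) (hxyz : x * y * z = 1)
    (ha : a = x + w * y + w ^ 2 * z) (hd : d = x + w ^ 2 * y + w * z) (hs : s = x + y + z) :
    27 = s ^ 3 + a ^ 3 + d ^ 3 - 3 * s * a * d := by
  subst ha hd hs
  grind

/-- Over a field containing `w`, `f = a ^ 2 * b / c ^ 2` and `g = b / a`, the cube `a ^ 3` and the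
coordinates of `x + y + z` and `x + w ^ 2 * y + w * z` along `1` and `a ^ 2` are rational. -/
theorem cyclic_cubic_generators_mem [CharZero F] {S : Type*} [SetLike S F] [SubfieldClass S F]
    (K : S) {f g : F} (hw : w ^ 2 + w + 1 = 0) (hwK : w ∈ K) (hxyz : x * y * z = 1)
    (ha : a = x + w * y + w ^ 2 * z)
    (hb : b = y * z + w * (x * z) + w ^ 2 * (x * y))
    (hc : c = x ^ 2 * z + y ^ 2 * x + z ^ 2 * y - 3)
    (ha0 : a ≠ 0) (hb0 : b ≠ 0) (hc0 : c ≠ 0)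
    (hf : f = a ^ 2 * b / c ^ 2) (hg : g = b / a) (hfK : f ∈ K) (hgK : g ∈ K) :
    a ^ 3 ∈ K ∧ x + y + z ∈ K ∧ ∃ r ∈ K, x + w ^ 2 * y + w * z = r * a ^ 2 := by
  obtain ⟨d, hd⟩ : ∃ d, d = x + w ^ 2 * y + w * z := ⟨_, rfl⟩
  obtain ⟨s, hs⟩ : ∃ s, s = x + y + z := ⟨_, rfl⟩
  have eb := three_mul_cyclic_quadratic hw ha hb hd hs
  have ec := nine_mul_cyclic_cubic hw hxyz ha hc hd hs
  have e27 := norm_relation_of_mul_eq_one hw hxyz ha hd hs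
  have hf0 : f ≠ 0 := by
    rw [hf]; exact div_ne_zero (mul_ne_zero (pow_ne_zero 2 ha0) hb0) (pow_ne_zero 2 hc0)
  have hg0 : g ≠ 0 := by rw [hg]; exact div_ne_zero hb0 ha0
  obtain ⟨r, hr⟩ : ∃ r, d = r * a ^ 2 := ⟨d / a ^ 2, by field_simp⟩
  obtain ⟨C, hC⟩ : ∃ C, c = C * a ^ 3 := ⟨c / a ^ 3, by field_simp⟩
  have hb' : b = g * a := by rw [hg]; field_simp
  have hC0 : C ≠ 0 := by rintro rfl; simp [hC] at hc0
  have hA : f * C ^ 2 * a ^ 3 = g := by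
    rw [hf, hg, hC]; field_simp
  have es : s = r ^ 2 * a ^ 3 - 3 * g := by
    refine mul_right_cancel₀ ha0 ?_
    rw [hr, hb'] at eb
    linear_combination eb
  obtain ⟨v, hv⟩ : ∃ v, v = r ^ 3 * a ^ 3 - 1 := ⟨_, rfl⟩
  have eC : 9 * C = (1 - w) * v - 9 * (g * r) := by
    refine mul_right_cancel₀ (pow_ne_zero 3 ha0) ?_
    rw [hC, hr, es] at ec
    rw [hv]
    linear_combination ec + r ^ 3 * a ^ 6 * hw
  have eN : a ^ 3 * (v ^ 2 - 9 * v * (g * r) + 27 * (g * r) ^ 2) = 27 * (1 + g ^ 3) := by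
    rw [hr, es] at e27
    rw [hv]
    linear_combination -e27
  have e1 : v - (6 + 3 * w) * (g * r) = (6 + 3 * w) * C := by
    linear_combination -(2 + w) / 3 * eC + v / 3 * hw
  have e2 : (6 + 3 * w) * C * (v - (3 - 3 * w) * (g * r)) * a ^ 3 = 27 * (1 + g ^ 3) := by
    rw [← e1]
    linear_combination eN - 9 * a ^ 3 * (g * r) ^ 2 * hw
  have e3 : (6 + 3 * w) * (v - (3 - 3 * w) * (g * r)) * g = 27 * (1 + g ^ 3) * f * C := by
    linear_combination f * C * e2 - (6 + 3 * w) * (v - (3 - 3 * w) * (g * r)) * hA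
  obtain ⟨q, hq⟩ : ∃ q, q = g * r / C := ⟨_, rfl⟩
  have hq' : g * r = q * C := by rw [hq]; field_simp
  have hv' : v = (6 + 3 * w) * (1 + q) * C := by
    rw [hq'] at e1; linear_combination e1
  have hqK : q ∈ K := by
    have e4 : (6 + 3 * w) * (6 + 3 * w + (3 + 6 * w) * q) * g = 27 * (1 + g ^ 3) * f := by
      refine mul_right_cancel₀ hC0 ?_
      rw [hv', hq'] at e3
      linear_combination e3
    have e5 : (6 + 3 * w + (3 + 6 * w) * q) * g = (1 - w) * 3 * (1 + g ^ 3) * f := by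
      linear_combination (1 - w) / 9 * e4 + (6 + 3 * w + (3 + 6 * w) * q) * g / 3 * hw
    have e6 : 6 + 3 * w + (3 + 6 * w) * q = (1 - w) * 3 * (1 + g ^ 3) * f / g := by
      rw [← e5]; field_simp
    have : q = -(3 + 6 * w) / 27 * ((1 - w) * 3 * (1 + g ^ 3) * f / g - (6 + 3 * w)) := by
      rw [← e6]
      linear_combination 4 / 3 * q * hw
    rw [this]
    repeat' first
      | assumption | apply mul_mem | apply div_mem | apply sub_mem | apply add_mem
      | apply neg_mem | apply pow_mem | exact one_mem K | exact ofNat_mem K _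
  have hCK : C ∈ K := by
    have e7 : q ^ 3 * C = (v + 1) * (g ^ 2 * f) := by
      refine mul_right_cancel₀ (mul_ne_zero hg0 (pow_ne_zero 2 hC0)) ?_
      have hr3 : g ^ 3 * r ^ 3 = q ^ 3 * C ^ 3 := by rw [← mul_pow, hq', mul_pow]
      rw [hv]
      linear_combination -g * hr3 - g ^ 3 * r ^ 3 * hA
    have : C = (q ^ 3 / (g ^ 2 * f) - (6 + 3 * w) * (1 + q))⁻¹ := by
      refine eq_inv_of_mul_eq_one_right ?_
      rw [sub_mul, ← hv', div_mul_eq_mul_div, e7]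
      field_simp
      ring
    rw [this]
    repeat' first
      | assumption | apply inv_mem | apply mul_mem | apply div_mem | apply sub_mem | apply add_mem
      | apply pow_mem | exact one_mem K | exact ofNat_mem K _
  have hrK : r ∈ K := by
    rw [show r = q * C / g by rw [← hq']; field_simp]
    exact div_mem (mul_mem hqK hCK) hgK
  have hAK : a ^ 3 ∈ K := by
    rw [show a ^ 3 = g / (f * C ^ 2) by rw [← hA]; field_simp]
    exact div_mem hgK (mul_mem hfK (pow_mem hCK 2))
  refine ⟨hAK, ?_, r, hrK, by rw [← hd, hr]⟩
  rw [← hs, es]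
  exact sub_mem (mul_mem (pow_mem hrK 2) hAK) (mul_mem (ofNat_mem K 3) hgK)

end CyclicCubic

/-- A polynomial expression in algebraically independent elements is nonzero if the polynomial
does not vanish at some point. -/
theorem AlgebraicIndependent.aeval_ne_zero_of_eval_ne_zero {ι k F : Type*} [CommRing k]
    [CommRing F] [Algebra k F] {v : ι → F} (hv : AlgebraicIndependent k v)
    {p : MvPolynomial ι k} (u : ι → k) (h : MvPolynomial.eval u p ≠ 0) :
    MvPolynomial.aeval v p ≠ 0 := by
  intro h0
  rw [hv.eq_zero_of_aeval_eq_zero p h0, map_zero] at h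
  exact h rfl

/-- If `F` is generated by `n` algebraically independent elements and is algebraic over the
subfield generated by `n` elements, these are algebraically independent as well. -/
theorem AlgebraicIndependent.of_isAlgebraic_adjoin {ι k F : Type*} [Finite ι] [Field k] [Field F]
    [Algebra k F] {u v : ι → F} (hu : AlgebraicIndependent k u)
    (h : Algebra.IsAlgebraic (IntermediateField.adjoin k (Set.range v)) F) :
    AlgebraicIndependent k v := by
  have : Algebra.IsAlgebraic (Algebra.adjoin k (Set.range v)) F :=
    IntermediateField.isAlgebraic_adjoin_iff_top.mp h
  exact (Algebra.IsAlgebraic.isTranscendenceBasis_of_lift_le_trdeg_of_finite k v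
    hu.lift_cardinalMk_le_trdeg).1

/-- Substitution of algebraically independent elements in a rational function field. -/
theorem AlgebraicIndependent.exists_algHom_of_adjoin_eq_top {ι k F L : Type*} [Field k] [Field F]
    [Field L] [Algebra k F] [Algebra k L] {u : ι → F} {v : ι → L} (hu : AlgebraicIndependent k u)
    (htop : IntermediateField.adjoin k (Set.range u) = ⊤) (hv : AlgebraicIndependent k v) :
    ∃ φ : F →ₐ[k] L, ∀ i, φ (u i) = v i := by
  let ψ : F →ₐ[k] IntermediateField.adjoin k (Set.range u) :=
    ((IntermediateField.equivOfEq htop).trans IntermediateField.topEquiv).symm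
  refine ⟨((IntermediateField.adjoin k (Set.range v)).val.comp (hv.aevalEquivField.toAlgHom.comp
    hu.aevalEquivField.symm.toAlgHom)).comp ψ, fun i => ?_⟩
  have h : hu.aevalEquivField.symm (ψ (u i)) =
      algebraMap (MvPolynomial ι k) (FractionRing (MvPolynomial ι k)) (MvPolynomial.X i) := by
    rw [AlgEquiv.symm_apply_eq]
    refine Subtype.ext ?_
    rw [hu.aevalEquivField_algebraMap_apply_coe, MvPolynomial.aeval_X]
    rfl
  change ((hv.aevalEquivField (hu.aevalEquivField.symm (ψ (u i))) :) : L) = v i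
  rw [h, hv.aevalEquivField_algebraMap_apply_coe, MvPolynomial.aeval_X]

/-- The logarithmic bracket of `b / a` and `a ^ 2 * b / c ^ 2`. -/
theorem PoissonBracket.bracket_div_sq_mul_div_sq {k F : Type*} [Field k] [CharZero k] [Field F]
    [Algebra k F] (P : PoissonBracket k F) {a b c : F} (ha : a ≠ 0) (hc : c ≠ 0)
    (h : 3 * c * P.bracket b a - 2 * a * P.bracket b c + 2 * b * P.bracket a c = a * b * c) :
    P.bracket (b / a) (a ^ 2 * b / c ^ 2) = b / a * (a ^ 2 * b / c ^ 2) := by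
  have inv_left (u v : F) (hu : u ≠ 0) : P.bracket u⁻¹ v = P.bracket v u / u ^ 2 := by
    rw [P.antisymm, P.bracket_inv v hu, neg_neg]
  simp only [div_eq_mul_inv, pow_two, mul_inv, P.leibniz, P.leibniz_left, P.bracket_self,
    P.bracket_inv _ hc, inv_left a _ ha]
  rw [P.antisymm a c] at h
  field_simp
  linear_combination a * b * h

/-- The bracket relation satisfied by the Lagrange resolvents `a`, `b` and the invariant `c` of the
cyclic permutation of three elements with product one. -/
theorem PoissonBracket.cyclic_cubic_relation {k F : Type*} [Field k] [CharZero k] [Field F]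
    [Algebra k F] (P : PoissonBracket k F) {ω : k} {x y z a b c : F}
    (hw : algebraMap k F ω ^ 2 + algebraMap k F ω + 1 = 0) (hxyz : x * y * z = 1)
    (hyx : P.bracket y x = y * x) (hxz : P.bracket x z = x * z) (hzy : P.bracket z y = z * y)
    (ha : a = x + algebraMap k F ω * y + algebraMap k F ω ^ 2 * z)
    (hb : b = y * z + algebraMap k F ω * (x * z) + algebraMap k F ω ^ 2 * (x * y))
    (hc : c = x ^ 2 * z + y ^ 2 * x + z ^ 2 * y - 3) :
    3 * c * P.bracket b a - 2 * a * P.bracket b c + 2 * b * P.bracket a c = a * b * c := by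
  have hxy : P.bracket x y = -(y * x) := by rw [P.antisymm, hyx]
  have hzx : P.bracket z x = -(x * z) := by rw [P.antisymm, hxz]
  have hyz : P.bracket y z = -(z * y) := by rw [P.antisymm, hzy]
  have h3 (u : F) : P.bracket u 3 = 0 := by
    rw [← map_ofNat (algebraMap k F) 3, P.bracket_algebraMap]
  subst ha hb hc
  simp only [map_add, map_sub, LinearMap.add_apply, pow_two, P.leibniz, P.leibniz_left,
    P.bracket_self, P.bracket_algebraMap, P.algebraMap_bracket, hyx, hxz, hzy, hxy, hyz, hzx, h3]
  generalize algebraMap k F ω = w at *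
  clear hyx hxz hzy hxy hyz hzx h3
  grind

/-- Let `k` be a field of characteristic zero containing a primitive third
root of unity `ω`, let `F = k(x,y)` carry the Poisson bracket with `{y,x} = yx`, and let `σ`
be the `k`-algebra automorphism of `F` with `σ(x) = y`, `σ(y) = (xy)⁻¹`.  With
`a = x + ωy + ω²(xy)⁻¹`, `b = x⁻¹ + ωy⁻¹ + ω²xy`, `c = xy⁻¹ + xy² + x⁻²y⁻¹ − 3`,
`f = a²b/c²` and `g = b/a`, the elements `f` and `g` are fixed by `σ`, satisfy `{g,f} = gf`,
the subfield `k(f,g)` equals the fixed field `F^σ`, and consequently `F^σ` is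
Poisson-isomorphic to `F`. -/
theorem statement1
    (k : Type*) [Field k] [CharZero k] (ω : k) (hω : IsPrimitiveRoot ω 3)
    (F : Type*) [Field F] [Algebra k F] (x y : F)
    (hind : AlgebraicIndependent k ![x, y])
    (hgen : IntermediateField.adjoin k {x, y} = ⊤)
    (P : PoissonBracket k F) (hP : P.bracket y x = y * x)
    (σ : F ≃ₐ[k] F) (hσx : σ x = y) (hσy : σ y = (x * y)⁻¹)
    (a b c f g : F)
    (ha : a = x + algebraMap k F ω * y + algebraMap k F ω ^ 2 * (x * y)⁻¹)
    (hb : b = x⁻¹ + algebraMap k F ω * y⁻¹ + algebraMap k F ω ^ 2 * (x * y))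
    (hc : c = x * y⁻¹ + x * y ^ 2 + (x ^ 2)⁻¹ * y⁻¹ - 3)
    (hf : f = a ^ 2 * b / c ^ 2) (hg : g = b / a) :
    σ f = f ∧ σ g = g ∧ P.bracket g f = g * f ∧
      (∀ t : F, t ∈ IntermediateField.adjoin k {f, g} ↔ σ t = t) ∧
      ∃ e : ↥(fixedSubalgebra σ) ≃ₐ[k] F,
        ∀ (u v : ↥(fixedSubalgebra σ)) (huv : P.bracket (u : F) (v : F) ∈ fixedSubalgebra σ),
          e ⟨P.bracket (u : F) (v : F), huv⟩ = P.bracket (e u) (e v) := by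
  have hinj : Function.Injective (algebraMap k F) := (algebraMap k F).injective
  have : CharZero F := charZero_of_injective_algebraMap hinj
  set w := algebraMap k F ω with hwdef
  have hwprim : IsPrimitiveRoot w 3 := hω.map_of_injective hinj
  have hw3 : w ^ 3 = 1 := hwprim.pow_eq_one
  have hw : w ^ 2 + w + 1 = 0 := by
    have := hwprim.geom_sum_eq_zero (by norm_num)
    simp only [Finset.sum_range_succ, Finset.sum_range_zero] at this
    linear_combination this
  have hω0 : ω ≠ 0 := hω.ne_zero (by norm_num)
  have hx0 : x ≠ 0 := hind.ne_zero 0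
  have hy0 : y ≠ 0 := hind.ne_zero 1
  obtain ⟨z, hz⟩ : ∃ z, z = (x * y)⁻¹ := ⟨_, rfl⟩
  have hxyz : x * y * z = 1 := by rw [hz]; field_simp
  have hσz : σ z = x := by
    rw [hz, map_inv₀, map_mul, hσx, hσy]; field_simp
  have ha' : a = x + w * y + w ^ 2 * z := by rw [ha, hz]
  have hb' : b = y * z + w * (x * z) + w ^ 2 * (x * y) := by
    rw [hb, hz]; field_simp
  have hc' : c = x ^ 2 * z + y ^ 2 * x + z ^ 2 * y - 3 := by
    rw [hc, hz]; field_simp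
  have hσy' : σ y = z := by rw [hσy, hz]
  have hσw : σ w = w := σ.commutes ω
  have ha0 : a ≠ 0 := by
    intro h
    refine hind.aeval_ne_zero_of_eval_ne_zero (p := .X 0 ^ 2 * .X 1 + .C ω * (.X 0 * .X 1 ^ 2) +
      .C (ω ^ 2)) 0 (by simpa using hω0) ?_
    have : x ^ 2 * y + w * (x * y ^ 2) + w ^ 2 = x * y * a := by
      rw [ha]; field_simp
    simpa [h, MvPolynomial.algebraMap_eq, ← hwdef] using this
  have hb0 : b ≠ 0 := by
    intro h
    refine hind.aeval_ne_zero_of_eval_ne_zero (p := .X 1 + .C ω * .X 0 +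
      .C (ω ^ 2) * (.X 0 ^ 2 * .X 1 ^ 2)) ![1, 0] (by simpa using hω0) ?_
    have : y + w * x + w ^ 2 * (x ^ 2 * y ^ 2) = x * y * b := by
      rw [hb]; field_simp
    simpa [h, ← hwdef] using this
  have hc0 : c ≠ 0 := by
    intro h
    refine hind.aeval_ne_zero_of_eval_ne_zero (p := .X 0 ^ 3 + .X 0 ^ 3 * .X 1 ^ 3 + 1 -
      3 * (.X 0 ^ 2 * .X 1)) 0 (by simp) ?_
    have : x ^ 3 + x ^ 3 * y ^ 3 + 1 - 3 * (x ^ 2 * y) = x ^ 2 * y * c := by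
      rw [hc]; field_simp
    simpa [h] using this
  have hσa : σ a = w ^ 2 * a := by
    rw [ha']
    simp only [map_add, map_mul, map_pow, hσx, hσy', hσz, hσw]
    linear_combination (-y - w * z) * hw3
  have hσb : σ b = w ^ 2 * b := by
    rw [hb']
    simp only [map_add, map_mul, map_pow, hσx, hσy', hσz, hσw]
    linear_combination (-(x * z) - w * (x * y)) * hw3
  have hσc : σ c = c := by
    rw [hc']
    simp only [map_add, map_sub, map_mul, map_pow, map_ofNat, hσx, hσy', hσz]
    ring
  have hσf : σ f = f := by
    rw [hf]
    simp only [map_div₀, map_mul, map_pow, hσa, hσb, hσc]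
    congr 1
    linear_combination a ^ 2 * b * (w ^ 3 + 1) * hw3
  have hσg : σ g = g := by
    have hw0 : w ≠ 0 := by rintro h; simp [h] at hw3
    rw [hg, map_div₀, hσa, hσb, mul_div_mul_left _ _ (pow_ne_zero 2 hw0)]
  have hxz : P.bracket x z = x * z := by
    rw [hz, P.bracket_inv _ (mul_ne_zero hx0 hy0), P.leibniz, P.bracket_self, P.antisymm, hP]
    field_simp
    ring
  have hzy : P.bracket z y = z * y := by
    rw [hz, P.antisymm, P.bracket_inv _ (mul_ne_zero hx0 hy0), P.leibniz, P.bracket_self, hP]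
    field_simp
    ring
  have hPgf : P.bracket g f = g * f := by
    rw [hf, hg]
    exact P.bracket_div_sq_mul_div_sq ha0 hc0
      (P.cyclic_cubic_relation hw hxyz hP hxz hzy ha' hb' hc')
  set K := IntermediateField.adjoin k {f, g} with hK
  have hfK : f ∈ K := IntermediateField.subset_adjoin _ _ (by simp)
  have hgK : g ∈ K := IntermediateField.subset_adjoin _ _ (by simp)
  have hwK : w ∈ K := K.algebraMap_mem ω
  have hσK : ∀ t ∈ K, σ t = t := by
    intro t ht
    induction ht using IntermediateField.adjoin_induction with
    | mem u hu => rcases hu with rfl | rfl <;> assumption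
    | algebraMap r => exact σ.commutes r
    | add u v _ _ hu hv => rw [map_add, hu, hv]
    | mul u v _ _ hu hv => rw [map_mul, hu, hv]
    | inv u _ hu => rw [map_inv₀, hu]
  obtain ⟨ha3, hs, r, hr, hd⟩ := cyclic_cubic_generators_mem K hw hwK hxyz ha' hb' hc' ha0 hb0 hc0
    hf hg hfK hgK
  have htop : IntermediateField.adjoin K {a} = ⊤ := by
    set M := IntermediateField.adjoin K {a} with hM
    have hKM {t : F} (ht : t ∈ K) : t ∈ M := M.algebraMap_mem ⟨t, ht⟩
    have haM : a ∈ M := IntermediateField.mem_adjoin_simple_self K a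
    have hdM : x + w ^ 2 * y + w * z ∈ M := hd ▸ mul_mem (hKM hr) (pow_mem haM 2)
    have hwM := hKM hwK
    have h3M : (3 : F)⁻¹ ∈ M := inv_mem (ofNat_mem M 3)
    have hle : IntermediateField.adjoin k {x, y} ≤ M.restrictScalars k := by
      rw [IntermediateField.adjoin_le_iff]
      rintro t (rfl | rfl)
      · change t ∈ M
        have : t = 3⁻¹ * (t + y + z + a + (t + w ^ 2 * y + w * z)) := by
          rw [ha']
          linear_combination -(y + z) / 3 * hw
        rw [this]
        exact mul_mem h3M (add_mem (add_mem (hKM hs) haM) hdM)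
      · change t ∈ M
        have : t = 3⁻¹ * (x + t + z + w ^ 2 * a + w * (x + w ^ 2 * t + w * z)) := by
          rw [ha']
          linear_combination -(x + z) / 3 * hw - (2 * t / 3 + w * z / 3) * hw3
        rw [this]
        exact mul_mem h3M (add_mem (add_mem (hKM hs) (mul_mem (pow_mem hwM 2) haM))
          (mul_mem hwM hdM))
    rw [hgen] at hle
    exact eq_top_iff.mpr fun t _ => hle (IntermediateField.mem_top (x := t))
  have hmem (t : F) : t ∈ K ↔ σ t = t := by
    refine ⟨hσK t, K.mem_of_fixed_of_cube_mem σ hσK (ζ := ω ^ 2) (hω.pow_of_coprime 2 (by norm_num))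
      ?_ ha3 htop⟩
    rw [hσa, map_pow]
  have hrange : Set.range ![f, g] = {f, g} := by simp [Set.pair_comm]
  have halg : Algebra.IsAlgebraic K F := by
    have hint : IsIntegral K a :=
      .of_pow (n := 3) (by norm_num) (isIntegral_algebraMap (x := (⟨a ^ 3, ha3⟩ : K)))
    have := IntermediateField.isAlgebraic_adjoin_simple hint
    rw [htop] at this
    exact IntermediateField.topEquiv.isAlgebraic
  have hfg : AlgebraicIndependent k ![f, g] :=
    hind.of_isAlgebraic_adjoin (by rw [hrange]; exact halg)
  obtain ⟨φ, hφ⟩ := hind.exists_algHom_of_adjoin_eq_top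
    (by rw [← hgen]; congr 1; simp [Set.pair_comm]) hfg
  have hφx : φ x = f := hφ 0
  have hφy : φ y = g := hφ 1
  have hφrange : φ.fieldRange = K := by
    rw [AlgHom.fieldRange_eq_map, ← hgen, IntermediateField.adjoin_map, Set.image_pair, hφx, hφy]
  have hφmem (t : F) : φ t ∈ fixedSubalgebra σ :=
    (hmem _).mp (hφrange ▸ ⟨t, rfl⟩)
  let e : F ≃ₐ[k] fixedSubalgebra σ :=
    AlgEquiv.ofBijective (φ.codRestrict (fixedSubalgebra σ) hφmem) <| by
      refine ⟨fun u v huv => φ.injective (congrArg Subtype.val huv), fun ⟨t, ht⟩ => ?_⟩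
      have : t ∈ φ.fieldRange := hφrange ▸ (hmem t).mpr ht
      obtain ⟨u, hu⟩ := this
      exact ⟨u, Subtype.ext hu⟩
  refine ⟨hσf, hσg, hPgf, hmem, e.symm, fun u v huv => ?_⟩
  have he (u : fixedSubalgebra σ) : φ (e.symm u) = u := congrArg Subtype.val (e.apply_symm_apply u)
  rw [AlgEquiv.symm_apply_eq]
  refine Subtype.ext ?_
  change P.bracket (u : F) v = φ (P.bracket (e.symm u) (e.symm v))
  rw [P.map_bracket_of_adjoin_eq_top hgen φ, he, he]
  rw [hP, map_mul, hφx, hφy, hPgf]
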